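/- Let φ ∈ 𝒮(ℝ²,ℂ) be a Schwartz function and let m : ℝ² → ℝ be Lipschitz with constant L (i.e. |m(x) − m(y)| ≤ L|x−y| for all x,y). Then there exists a constant C > 0 depending only on φ such that for every h > 0 and every Schwartz function g ∈ 𝒮(ℝ²,ℂ): ‖φ(hD)(m·g) − m·(φ(hD)g)‖_{L²(ℝ²)} ≤ C L h ‖g‖_{L²(ℝ²)}, where φ(hD)g := 𝓕⁻¹(ξ ↦ φ(hξ) 𝓕g(ξ)). In particular the commutator of the semiclassical Fourier multiplier φ(hD) with multiplication by a Lipschitz function has L²-operator norm O(h). -/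

import Mathlib

open MeasureTheory Complex

noncomputable section

def enorm2 (v : ℝ × ℝ) : ℝ := Real.sqrt (v.1 ^ 2 + v.2 ^ 2)

def l2normC (g : ℝ × ℝ → ℂ) : ℝ := Real.sqrt (∫ x : ℝ × ℝ, ‖g x‖ ^ 2)

/-- Fourier transform on ℝ² (unitary convention `(2π)⁻¹ ∫ e^{-ix·ξ}`). -/
def ft2 (g : ℝ × ℝ → ℂ) (ξ : ℝ × ℝ) : ℂ :=
  ((2 * Real.pi : ℝ) : ℂ)⁻¹ *
    ∫ x : ℝ × ℝ, Complex.exp (-(Complex.I * ((x.1 * ξ.1 + x.2 * ξ.2 : ℝ) : ℂ))) * g x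

/-- Inverse Fourier transform on ℝ². -/
def ift2 (h : ℝ × ℝ → ℂ) (x : ℝ × ℝ) : ℂ :=
  ((2 * Real.pi : ℝ) : ℂ)⁻¹ *
    ∫ ξ : ℝ × ℝ, Complex.exp (Complex.I * ((x.1 * ξ.1 + x.2 * ξ.2 : ℝ) : ℂ)) * h ξ

/-- Scalar Fourier multiplier `b(D)`. -/
def fmult1 (b : ℝ × ℝ → ℂ) (g : ℝ × ℝ → ℂ) (x : ℝ × ℝ) : ℂ :=
  ift2 (fun ξ => b ξ * ft2 g ξ) x

open scoped FourierTransform Convolution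

/-- the phase pairing, scaled to Mathlib's convention -/
def pairL : (ℝ × ℝ) →L[ℝ] (ℝ × ℝ) →L[ℝ] ℝ :=
  (-(2 * Real.pi)⁻¹) •
    ((ContinuousLinearMap.mul ℝ ℝ).bilinearComp (ContinuousLinearMap.fst ℝ ℝ ℝ)
        (ContinuousLinearMap.fst ℝ ℝ ℝ)
      + (ContinuousLinearMap.mul ℝ ℝ).bilinearComp (ContinuousLinearMap.snd ℝ ℝ ℝ)
        (ContinuousLinearMap.snd ℝ ℝ ℝ))

lemma pairL_apply (v w : ℝ × ℝ) :
    pairL v w = -(2 * Real.pi)⁻¹ * (v.1 * w.1 + v.2 * w.2) := by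
  simp [pairL]
  ring

def kern (b : ℝ × ℝ → ℂ) (z : ℝ × ℝ) : ℂ :=
  ∫ ξ : ℝ × ℝ, Complex.exp (Complex.I * ((z.1 * ξ.1 + z.2 * ξ.2 : ℝ) : ℂ)) * b ξ

lemma norm_phase (t : ℝ) : ‖Complex.exp (Complex.I * (t : ℂ))‖ = 1 := by
  rw [mul_comm]; exact Complex.norm_exp_ofReal_mul_I t

lemma kern_eq (b : ℝ × ℝ → ℂ) :
    kern b = VectorFourier.fourierIntegral 𝐞 volume pairL.toLinearMap₁₂ b := by
  funext z
  unfold kern VectorFourier.fourierIntegral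
  congr 1
  funext ξ
  have : pairL.toLinearMap₁₂ ξ z = pairL ξ z := rfl
  rw [this, pairL_apply, Circle.smul_def, Real.fourierChar_apply, smul_eq_mul]
  congr 2
  have hpi : (Real.pi : ℂ) ≠ 0 := by exact_mod_cast Real.pi_ne_zero
  push_cast
  field_simp

lemma kern_cont {b : ℝ × ℝ → ℂ} (hb : Integrable b) : Continuous (kern b) := by
  rw [kern_eq]
  exact VectorFourier.fourierIntegral_continuous Real.continuous_fourierChar
    pairL.continuous₂ hb

lemma kern_bound (φ : SchwartzMap (ℝ × ℝ) ℂ) (n : ℕ) :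
    ∃ C, ∀ w, ‖w‖ ^ n * ‖kern φ w‖ ≤ C := by
  have key : ∀ v : ℝ × ℝ, ∃ C : ℝ, ∀ w : ℝ × ℝ, |pairL v w| ^ n * ‖kern φ w‖ ≤ C := by
    intro v
    refine ⟨‖v‖ ^ n * (2 * Real.pi * ‖pairL‖) ^ 0 * (2 * ((0 : ℕ) : ℝ) + 2) ^ n *
        ∑ p ∈ Finset.range (0 + 1) ×ˢ Finset.range (n + 1),
          ∫ v, ‖v‖ ^ p.1 * ‖iteratedFDeriv ℝ p.2 φ v‖, fun w => ?_⟩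
    have := VectorFourier.pow_mul_norm_iteratedFDeriv_fourierIntegral_le pairL
      (μ := (volume : Measure (ℝ × ℝ))) (K := ⊤) (N := ⊤) (f := φ) (φ.smooth ⊤)
      (fun k n _ _ => φ.integrable_pow_mul_iteratedFDeriv volume k n) (k := 0) (n := n)
      le_top le_top v w
    rw [norm_iteratedFDeriv_zero, ← kern_eq] at this
    exact this
  obtain ⟨C1, h1⟩ := key (2 * Real.pi, 0)
  obtain ⟨C2, h2⟩ := key (0, 2 * Real.pi)
  have hpi := Real.pi_ne_zero
  refine ⟨max C1 C2, fun w => ?_⟩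
  have a1 : |pairL (2 * Real.pi, 0) w| = |w.1| := by
    rw [pairL_apply]; rw [← abs_neg]; congr 1; field_simp; simp
  have a2 : |pairL (0, 2 * Real.pi) w| = |w.2| := by
    rw [pairL_apply]; rw [← abs_neg]; congr 1; field_simp; simp
  have h1 := h1 w
  have h2 := h2 w
  rw [a1] at h1
  rw [a2] at h2
  rw [Prod.norm_def]
  rcases max_cases ‖w.1‖ ‖w.2‖ with ⟨h, _⟩ | ⟨h, _⟩ <;> rw [h]
  · exact h1.trans (le_max_left _ _)
  · exact h2.trans (le_max_right _ _)

lemma kern_integrable (φ : SchwartzMap (ℝ × ℝ) ℂ) :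
    Integrable (fun w => ‖w‖ * ‖kern φ w‖) := by
  obtain ⟨C1, h1⟩ := kern_bound φ 0
  obtain ⟨C2, h2⟩ := kern_bound φ (1 + (volume : Measure (ℝ × ℝ)).integrablePower)
  simpa using integrable_of_le_of_pow_mul_le (μ := (volume : Measure (ℝ × ℝ))) (k := 1)
    (f := kern φ) (by simpa using h1) h2 (kern_cont φ.integrable).aestronglyMeasurable

lemma kern_scale (φ : ℝ × ℝ → ℂ) {h : ℝ} (hh : 0 < h) (z : ℝ × ℝ) :
    kern (fun ξ => φ (h • ξ)) z = ((h ^ 2)⁻¹ : ℝ) • kern φ (h⁻¹ • z) := by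
  unfold kern
  have := Measure.integral_comp_smul (volume : Measure (ℝ × ℝ))
    (fun ξ : ℝ × ℝ => Complex.exp (Complex.I *
      (((h⁻¹ • z).1 * ξ.1 + (h⁻¹ • z).2 * ξ.2 : ℝ) : ℂ)) * φ ξ) h
  have hf : Module.finrank ℝ (ℝ × ℝ) = 2 := by simp
  rw [hf, abs_of_pos (by positivity)] at this
  rw [← this]
  congr 1
  funext ξ
  congr 4
  simp only [Prod.smul_fst, Prod.smul_snd, smul_eq_mul]
  field_simp

lemma fmult_eq {b f : ℝ × ℝ → ℂ} (hb : Integrable b) (hf : Integrable f) (x : ℝ × ℝ) :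
    fmult1 b f x = (((2 * Real.pi : ℝ) : ℂ)⁻¹) ^ 2 * ∫ y, kern b (x - y) * f y := by
  unfold fmult1 ift2 ft2 kern
  have e1 : ∀ ξ : ℝ × ℝ, Complex.exp (Complex.I * ((x.1 * ξ.1 + x.2 * ξ.2 : ℝ) : ℂ)) *
      (b ξ * (((2 * Real.pi : ℝ) : ℂ)⁻¹ *
        ∫ y : ℝ × ℝ, Complex.exp (-(Complex.I * ((y.1 * ξ.1 + y.2 * ξ.2 : ℝ) : ℂ))) * f y))
      = ((2 * Real.pi : ℝ) : ℂ)⁻¹ * ∫ y : ℝ × ℝ,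
        Complex.exp (Complex.I * (((x - y).1 * ξ.1 + (x - y).2 * ξ.2 : ℝ) : ℂ)) *
          (b ξ * f y) := by
    intro ξ
    rw [mul_left_comm (b ξ), mul_left_comm, ← mul_assoc (Complex.exp _), ← integral_const_mul]
    congr 2
    funext y
    have : Complex.exp (Complex.I * (((x - y).1 * ξ.1 + (x - y).2 * ξ.2 : ℝ) : ℂ))
      = Complex.exp (Complex.I * ((x.1 * ξ.1 + x.2 * ξ.2 : ℝ) : ℂ)) *
        Complex.exp (-(Complex.I * ((y.1 * ξ.1 + y.2 * ξ.2 : ℝ) : ℂ))) := by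
      rw [← Complex.exp_add]
      congr 1
      simp only [Prod.fst_sub, Prod.snd_sub]
      push_cast
      ring
    rw [this]
    ring
  simp_rw [e1]
  rw [integral_const_mul, ← mul_assoc, ← sq]
  congr 1
  rw [integral_integral_swap]
  · congr 1
    funext y
    rw [← integral_mul_const]
    congr 1
    funext ξ
    ring
  · have hprod : Integrable (fun p : (ℝ × ℝ) × (ℝ × ℝ) => b p.1 * f p.2)
      (volume.prod volume) := hb.mul_prod hf
    refine hprod.norm.mono' ?_ ?_
    · refine AEStronglyMeasurable.mul ?_ hprod.aestronglyMeasurable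
      apply Continuous.aestronglyMeasurable
      simp only [Prod.fst_sub, Prod.snd_sub]
      fun_prop
    · refine Filter.Eventually.of_forall fun p => ?_
      simp only [Function.uncurry]
      rw [norm_mul, norm_phase, one_mul]

/-- Cauchy-Schwarz with a weight. -/
lemma cs_weight {k u : ℝ × ℝ → ℝ} (hk : ∀ y, 0 ≤ k y) (i0 : Integrable k)
    (i1 : Integrable (fun y => k y * u y)) (i2 : Integrable (fun y => k y * u y ^ 2)) :
    (∫ y, k y * u y) ^ 2 ≤ (∫ y, k y) * ∫ y, k y * u y ^ 2 := by
  have h : ∀ t : ℝ, 0 ≤ (∫ y, k y) * (t * t) + (-2 * ∫ y, k y * u y) * t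
      + ∫ y, k y * u y ^ 2 := by
    intro t
    have : 0 ≤ ∫ y, (k y * (t * t) + (-2 * (k y * u y)) * t + k y * u y ^ 2) := by
      apply integral_nonneg
      intro y
      have := mul_nonneg (hk y) (sq_nonneg (t - u y))
      simp only [Pi.zero_apply]
      linarith
    have i3 : Integrable (fun y => k y * (t * t) + (-2 * (k y * u y)) * t) :=
      (i0.mul_const _).add ((i1.const_mul _).mul_const _)
    rw [integral_add i3 i2, integral_add (i0.mul_const _) ((i1.const_mul _).mul_const _), integral_mul_const,
      integral_mul_const, integral_const_mul] at this
    exact this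
  have := discrim_le_zero h
  unfold discrim at this
  linarith

lemma enorm2_le (v : ℝ × ℝ) : enorm2 v ≤ 2 * ‖v‖ := by
  unfold enorm2
  apply Real.sqrt_le_iff.2
  refine ⟨by positivity, ?_⟩
  have h1 : v.1 ^ 2 ≤ ‖v‖ ^ 2 := by
    rw [← sq_abs]; gcongr; exact norm_fst_le v
  have h2 : v.2 ^ 2 ≤ ‖v‖ ^ 2 := by
    rw [← sq_abs]; gcongr; exact norm_snd_le v
  nlinarith [sq_nonneg ‖v‖]

/-- the commutator of the semiclassical Fourier multiplier `φ(hD)` with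
multiplication by a Lipschitz function has L²-operator norm `O(h)`. -/
theorem stmt7 (φ : SchwartzMap (ℝ × ℝ) ℂ) :
    ∃ C > (0:ℝ), ∀ (L : ℝ) (m : ℝ × ℝ → ℝ),
      (∀ x y : ℝ × ℝ, |m x - m y| ≤ L * enorm2 (x - y)) →
      ∀ h > (0:ℝ), ∀ g : SchwartzMap (ℝ × ℝ) ℂ,
        l2normC (fun x =>
            fmult1 (fun ξ => φ (h • ξ)) (fun z => (m z : ℂ) * g z) x
              - (m x : ℂ) * fmult1 (fun ξ => φ (h • ξ)) (fun z => g z) x)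
          ≤ C * L * h * l2normC (fun z => g z) := by
  set A : ℝ := ∫ w, ‖w‖ * ‖kern φ w‖ with hA
  have hA0 : 0 ≤ A := integral_nonneg fun w => by positivity
  set D : ℝ := ((2 * Real.pi)⁻¹) ^ 2 with hD
  have hD0 : 0 ≤ D := by positivity
  refine ⟨2 * D * A + 1, by positivity, ?_⟩
  intro L m hm h hh g
  have hL : 0 ≤ L := by
    have h1 := (abs_nonneg _).trans (hm (1, 0) 0)
    have : enorm2 ((1, 0) - 0) = 1 := by simp [enorm2]
    rwa [this, mul_one] at h1
  have hm2 : ∀ x y, |m x - m y| ≤ 2 * L * ‖x - y‖ := fun x y =>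
    (hm x y).trans (by nlinarith [mul_le_mul_of_nonneg_left (enorm2_le (x - y)) hL])
  have hmc : Continuous m := by
    have : LipschitzWith (Real.toNNReal (2 * L)) m := by
      apply LipschitzWith.of_dist_le_mul
      intro x y
      rw [Real.coe_toNNReal _ (by positivity), dist_eq_norm, dist_eq_norm]
      exact hm2 x y
    exact this.continuous
  have hb : Integrable (fun ξ => φ (h • ξ)) := φ.integrable.comp_smul hh.ne'
  have hg : Integrable (fun z => g z) := g.integrable
  have hmg : Integrable (fun z => (m z : ℂ) * g z) := by
    have i1 := (hg.norm.const_mul |m 0|).add ((g.integrable_pow_mul volume 1).const_mul (2 * L))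
    refine i1.mono' ?_ ?_
    · apply Continuous.aestronglyMeasurable
      have := g.continuous
      fun_prop
    · refine Filter.Eventually.of_forall fun z => ?_
      have h1 : |m z| ≤ |m 0| + 2 * L * ‖z‖ := by
        have h2 := hm2 z 0
        rw [sub_zero] at h2
        have h3 := abs_add_le (m 0) (m z - m 0)
        rw [add_sub_cancel] at h3
        linarith
      simp only [Pi.add_apply, norm_mul, Complex.norm_real, Real.norm_eq_abs, pow_one]
      nlinarith [mul_le_mul_of_nonneg_right h1 (norm_nonneg (g z))]
  -- the weight
  set K : ℝ × ℝ → ℂ := kern (fun ξ => φ (h • ξ)) with hK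
  have hKc : Continuous K := kern_cont hb
  set k : ℝ × ℝ → ℝ := fun z => ‖z‖ * ‖K z‖ with hk
  have hk0 : ∀ z, 0 ≤ k z := fun z => by positivity
  have hkc : Continuous k := by fun_prop
  have hks : k = fun z => h⁻¹ * (fun w => ‖w‖ * ‖kern φ w‖) (h⁻¹ • z) := by
    funext z
    simp only [hk, hK, kern_scale φ hh, norm_smul, norm_inv, norm_pow, Real.norm_eq_abs,
      abs_of_pos hh]
    field_simp
  have hki : Integrable k := by
    rw [hks]
    exact ((kern_integrable φ).comp_smul (inv_pos.2 hh).ne').const_mul _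
  have hkA : ∫ z, k z = h * A := by
    rw [hks, integral_const_mul, Measure.integral_comp_inv_smul_of_nonneg volume
      (fun w => ‖w‖ * ‖kern φ w‖) hh.le, ← hA]
    have hf : Module.finrank ℝ (ℝ × ℝ) = 2 := by simp
    rw [hf, smul_eq_mul]
    field_simp
  obtain ⟨B, hB⟩ : ∃ B, ∀ z, k z ≤ B := by
    obtain ⟨C, hC⟩ := kern_bound φ 1
    refine ⟨h⁻¹ * C, fun z => ?_⟩
    rw [hks]
    have := hC (h⁻¹ • z)
    rw [pow_one] at this
    exact mul_le_mul_of_nonneg_left this (by positivity)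
  obtain ⟨BK, hBK⟩ : ∃ B, ∀ z, ‖K z‖ ≤ B := by
    obtain ⟨C, hC⟩ := kern_bound φ 0
    refine ⟨(h ^ 2)⁻¹ * C, fun z => ?_⟩
    rw [hK, kern_scale φ hh, norm_smul, Real.norm_of_nonneg (by positivity)]
    have := hC (h⁻¹ • z)
    rw [pow_zero, one_mul] at this
    exact mul_le_mul_of_nonneg_left this (by positivity)
  have hg2 : Integrable (fun z => ‖g z‖ ^ 2) := by
    have := (memLp_two_iff_integrable_sq_norm g.continuous.aestronglyMeasurable).1
      (g.memLp 2 (volume : Measure (ℝ × ℝ)))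
    exact this
  have bi : ∀ (x : ℝ × ℝ) (u : ℝ × ℝ → ℝ), Integrable u →
      Integrable (fun y => k (x - y) * u y) := by
    intro x u hu
    refine hu.bdd_mul (c := B) ?_ ?_
    · exact (by fun_prop : Continuous fun y => k (x - y)).aestronglyMeasurable
    · refine Filter.Eventually.of_forall fun y => ?_
      rw [Real.norm_of_nonneg (hk0 _)]
      exact hB _
  have bK : ∀ (x : ℝ × ℝ) (u : ℝ × ℝ → ℂ), Integrable u →
      Integrable (fun y => K (x - y) * u y) := by
    intro x u hu
    refine hu.bdd_mul (c := BK) ?_ ?_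
    · exact (by fun_prop : Continuous fun y => K (x - y)).aestronglyMeasurable
    · exact Filter.Eventually.of_forall fun y => hBK _
  -- pointwise bound
  have pt : ∀ x, ‖fmult1 (fun ξ => φ (h • ξ)) (fun z => (m z : ℂ) * g z) x
      - (m x : ℂ) * fmult1 (fun ξ => φ (h • ξ)) (fun z => g z) x‖
      ≤ D * (2 * L) * ∫ y, k (x - y) * ‖g y‖ := by
    intro x
    rw [fmult_eq hb hmg, fmult_eq hb hg, mul_left_comm, ← mul_sub, ← integral_const_mul,
      ← integral_sub (bK x _ hmg) ((bK x _ hg).const_mul _), norm_mul, mul_assoc]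
    have hDn : ‖(((2 * Real.pi : ℝ) : ℂ)⁻¹) ^ 2‖ = D := by
      rw [norm_pow, norm_inv, Complex.norm_real, Real.norm_of_nonneg (by positivity)]
    rw [hDn]
    refine mul_le_mul_of_nonneg_left ?_ hD0
    rw [← integral_const_mul]
    refine norm_integral_le_of_norm_le ((bi x _ hg.norm).const_mul _) ?_
    refine Filter.Eventually.of_forall fun y => ?_
    have e : kern (fun ξ => φ (h • ξ)) (x - y) * ((m y : ℂ) * g y)
        - (m x : ℂ) * (kern (fun ξ => φ (h • ξ)) (x - y) * g y)
        = ((m y - m x : ℝ) : ℂ) * (K (x - y) * g y) := by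
      rw [hK]; push_cast; ring
    rw [e, norm_mul, norm_mul, Complex.norm_real, Real.norm_eq_abs, abs_sub_comm]
    calc |m x - m y| * (‖K (x - y)‖ * ‖g y‖)
        ≤ 2 * L * ‖x - y‖ * (‖K (x - y)‖ * ‖g y‖) :=
          mul_le_mul_of_nonneg_right (hm2 x y) (by positivity)
      _ = 2 * L * (k (x - y) * ‖g y‖) := by simp only [hk]; ring
  have conv_eq : ∀ x, (k ⋆[ContinuousLinearMap.mul ℝ ℝ, volume] (fun z => ‖g z‖ ^ 2)) x
      = ∫ y, k (x - y) * ‖g y‖ ^ 2 := by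
    intro x
    rw [convolution_eq_swap]
    rfl
  have convI : Integrable (fun x => ∫ y, k (x - y) * ‖g y‖ ^ 2) := by
    simp_rw [← conv_eq]
    exact hki.integrable_convolution _ hg2
  have convV : ∫ x, ∫ y, k (x - y) * ‖g y‖ ^ 2 = h * A * ∫ z, ‖g z‖ ^ 2 := by
    simp_rw [← conv_eq]
    rw [integral_convolution _ hki hg2, hkA]
    rfl
  set S : ℝ := ∫ z, ‖g z‖ ^ 2 with hS
  have hS0 : 0 ≤ S := integral_nonneg fun z => by positivity
  have fin : ∫ x, ‖fmult1 (fun ξ => φ (h • ξ)) (fun z => (m z : ℂ) * g z) x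
      - (m x : ℂ) * fmult1 (fun ξ => φ (h • ξ)) (fun z => g z) x‖ ^ 2
      ≤ (D * (2 * L) * (h * A)) ^ 2 * S := by
    have : (D * (2 * L) * (h * A)) ^ 2 * S
        = ∫ x, (D * (2 * L)) ^ 2 * (h * A) * ∫ y, k (x - y) * ‖g y‖ ^ 2 := by
      rw [integral_const_mul, convV]; ring
    rw [this]
    refine integral_mono_of_nonneg (Filter.Eventually.of_forall fun x => by positivity)
      (convI.const_mul _) (Filter.Eventually.of_forall fun x => ?_)
    have c := cs_weight (k := fun y => k (x - y)) (u := fun y => ‖g y‖) (fun y => hk0 _)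
      (hki.comp_sub_left x) (bi x _ hg.norm) (bi x _ hg2)
    rw [integral_sub_left_eq_self k volume x, hkA] at c
    calc _ ≤ (D * (2 * L) * ∫ y, k (x - y) * ‖g y‖) ^ 2 :=
          pow_le_pow_left₀ (norm_nonneg _) (pt x) 2
      _ = (D * (2 * L)) ^ 2 * (∫ y, k (x - y) * ‖g y‖) ^ 2 := by ring
      _ ≤ (D * (2 * L)) ^ 2 * ((h * A) * ∫ y, k (x - y) * ‖g y‖ ^ 2) :=
          mul_le_mul_of_nonneg_left c (by positivity)
      _ = _ := by ring
  have hl : l2normC (fun z => g z) = Real.sqrt S := rfl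
  rw [hl]
  unfold l2normC
  calc _ ≤ Real.sqrt ((D * (2 * L) * (h * A)) ^ 2 * S) := Real.sqrt_le_sqrt fin
    _ = D * (2 * L) * (h * A) * Real.sqrt S := by
        rw [Real.sqrt_mul (by positivity), Real.sqrt_sq (by positivity)]
    _ ≤ (2 * D * A + 1) * L * h * Real.sqrt S := by
        refine mul_le_mul_of_nonneg_right ?_ (Real.sqrt_nonneg _)
        nlinarith [mul_nonneg hL hh.le]
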